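/- Let 0 < s < n and let G_s be the Bessel kernel satisfying G_s(y) ≤ C|y|^{s−n} for |y| ≤ 1 and G_s(y) ≤ C e^{−|y|/4} for |y| ≥ 1. Then the bilinear Bessel potential J_s maps L¹(ℝⁿ) × L¹(ℝⁿ) boundedly into L^{1/2}(ℝⁿ): ∫ |J_s(f,g)(x)|^{1/2} dx ≤ C' ‖f‖_{L¹}^{1/2} ‖g‖_{L¹}^{1/2}. -/

import Mathlib

open MeasureTheory Set ENNReal

namespace BilinearPotential

variable {E : Type*} [NormedAddCommGroup E] [NormedSpace ℝ E] [FiniteDimensional ℝ E]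
  [MeasurableSpace E] [BorelSpace E] (μ : Measure E) [μ.IsAddHaarMeasure]

lemma lintegral_setLIntegral_closedBall (R : ℝ) {h : E → ℝ≥0∞} (hh : Measurable h) :
    ∫⁻ z, ∫⁻ x in Metric.closedBall z R, h x ∂μ ∂μ
      = μ (Metric.closedBall 0 R) * ∫⁻ x, h x ∂μ := by
  have hind : ∀ z x : E, (Metric.closedBall z R).indicator h x
      = (Metric.closedBall x R).indicator (fun _ => h x) z := fun z x => by
    simp only [indicator, Metric.mem_closedBall, dist_comm]
  have hmeas : Measurable (Function.uncurry fun z x : E =>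
      (Metric.closedBall z R).indicator h x) :=
    (hh.comp measurable_snd).indicator
      (measurableSet_le (measurable_snd.dist measurable_fst) measurable_const)
  simp_rw [← lintegral_indicator Metric.isClosed_closedBall.measurableSet]
  rw [lintegral_lintegral_swap hmeas.aemeasurable, ← lintegral_const_mul _ hh]
  congr 1 with x
  simp_rw [hind]
  rw [lintegral_indicator Metric.isClosed_closedBall.measurableSet, setLIntegral_const,
    Measure.addHaar_closedBall_center, mul_comm]

lemma lintegral_two_smul_sub_le {Γ : E → ℝ≥0∞} (hΓ : Measurable Γ) (y : E) :
    ∫⁻ x, Γ ((2 : ℝ) • x - y) ∂μ ≤ ∫⁻ x, Γ x ∂μ := by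
  have hm : Measurable fun u => Γ (u - y) := hΓ.comp (measurable_id.sub_const y)
  have h := lintegral_map (μ := μ) hm (measurable_const_smul (2 : ℝ))
  rw [← h, Measure.map_addHaar_smul μ two_ne_zero, lintegral_smul_measure,
    lintegral_sub_right_eq_self]
  refine mul_le_of_le_one_left' ?_
  rw [ENNReal.ofReal_le_one, abs_of_pos (by positivity)]
  exact inv_le_one_of_one_le₀ (one_le_pow₀ one_le_two)

lemma lintegral_lintegral_sub_mul_add_le {F Γ : E → ℝ≥0∞} (hF : Measurable F)
    (hΓ : Measurable Γ) :
    ∫⁻ x, ∫⁻ y, F (x - y) * Γ (x + y) ∂μ ∂μ ≤ (∫⁻ x, F x ∂μ) * ∫⁻ x, Γ x ∂μ := by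
  have hsub : ∀ x, ∫⁻ y, F (x - y) * Γ (x + y) ∂μ = ∫⁻ y, F y * Γ ((2 : ℝ) • x - y) ∂μ := by
    intro x
    rw [← lintegral_sub_left_eq_self (fun y => F y * Γ ((2 : ℝ) • x - y)) x]
    congr 1 with y
    congr 2
    module
  simp_rw [hsub]
  rw [lintegral_lintegral_swap, ← lintegral_mul_const _ hF]
  · refine lintegral_mono fun y => ?_
    rw [lintegral_const_mul _ (by fun_prop)]
    exact mul_le_mul_right (lintegral_two_smul_sub_le μ hΓ y) _
  · exact Measurable.aemeasurable (by fun_prop)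

/-- The bilinear averaging operator over the ball of radius `R`. -/
noncomputable def bilinearAverage (R : ℝ) (F Γ : E → ℝ≥0∞) (x : E) : ℝ≥0∞ :=
  ∫⁻ y in Metric.closedBall 0 R, F (x - y) * Γ (x + y) ∂μ

lemma measurable_bilinearAverage (R : ℝ) {F Γ : E → ℝ≥0∞} (hF : Measurable F)
    (hΓ : Measurable Γ) : Measurable (bilinearAverage μ R F Γ) :=
  Measurable.lintegral_prod_right (f := fun x y => F (x - y) * Γ (x + y)) (by fun_prop)

lemma setLIntegral_bilinearAverage_le (R : ℝ) {F Γ : E → ℝ≥0∞} (hF : Measurable F)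
    (hΓ : Measurable Γ) (z : E) :
    ∫⁻ x in Metric.closedBall z R, bilinearAverage μ R F Γ x ∂μ
      ≤ (∫⁻ x in Metric.closedBall z (2 * R), F x ∂μ)
        * ∫⁻ x in Metric.closedBall z (2 * R), Γ x ∂μ := by
  have hb : ∀ r, MeasurableSet (Metric.closedBall z r) :=
    fun r => Metric.isClosed_closedBall.measurableSet
  rw [← lintegral_indicator (hb (2 * R)) F, ← lintegral_indicator (hb (2 * R)) Γ]
  refine le_trans ?_ (lintegral_lintegral_sub_mul_add_le μ (hF.indicator (hb _))
    (hΓ.indicator (hb _)))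
  refine le_trans (setLIntegral_mono' (hb R) fun x hx => ?_) (setLIntegral_le_lintegral _ _)
  refine le_trans (setLIntegral_mono' Metric.isClosed_closedBall.measurableSet fun y hy => ?_)
    (setLIntegral_le_lintegral _ _)
  rw [Metric.mem_closedBall, dist_eq_norm] at hx
  rw [mem_closedBall_zero_iff] at hy
  rw [indicator_of_mem, indicator_of_mem]
  · rw [Metric.mem_closedBall, dist_eq_norm, add_sub_right_comm]
    exact (norm_add_le _ _).trans (by linarith)
  · rw [Metric.mem_closedBall, dist_eq_norm, sub_right_comm]
    exact (norm_sub_le _ _).trans (by linarith)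

/-- The Kenig-Stein bound for the bilinear average. -/
lemma lintegral_bilinearAverage_rpow_le {R : ℝ} (hR : 0 < R) {F Γ : E → ℝ≥0∞}
    (hF : Measurable F) (hΓ : Measurable Γ) :
    ∫⁻ x, bilinearAverage μ R F Γ x ^ (1 / 2 : ℝ) ∂μ
      ≤ 2 ^ Module.finrank ℝ E * μ (Metric.closedBall 0 R) ^ (1 / 2 : ℝ)
        * ((∫⁻ x, F x ∂μ) ^ (1 / 2 : ℝ) * (∫⁻ x, Γ x ∂μ) ^ (1 / 2 : ℝ)) := by
  set V := μ (Metric.closedBall 0 R) with hV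
  have hV0 : V ≠ 0 := (Metric.measure_closedBall_pos μ 0 hR).ne'
  have hVtop : V ≠ ∞ := measure_closedBall_lt_top.ne
  have hV2 : μ (Metric.closedBall 0 (2 * R)) = 2 ^ Module.finrank ℝ E * V := by
    rw [hV, Measure.addHaar_closedBall_mul μ 0 zero_le_two hR.le,
      ENNReal.ofReal_pow zero_le_two, ENNReal.ofReal_ofNat]
  have hB := measurable_bilinearAverage μ R hF hΓ
  have hball : ∀ (r : ℝ) {h : E → ℝ≥0∞}, Measurable h →
      Measurable fun z => ∫⁻ x in Metric.closedBall z r, h x ∂μ := by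
    intro r h hh
    simp_rw [← lintegral_indicator Metric.isClosed_closedBall.measurableSet]
    refine Measurable.lintegral_prod_right (f := fun z x =>
      (Metric.closedBall z r).indicator h x) ?_
    exact (hh.comp measurable_snd).indicator
      (measurableSet_le (measurable_snd.dist measurable_fst) measurable_const)
  have hlocal : ∀ z, ∫⁻ x in Metric.closedBall z R, bilinearAverage μ R F Γ x ^ (1 / 2 : ℝ) ∂μ
      ≤ V ^ (1 / 2 : ℝ) * ((∫⁻ x in Metric.closedBall z (2 * R), F x ∂μ) ^ (1 / 2 : ℝ)
        * (∫⁻ x in Metric.closedBall z (2 * R), Γ x ∂μ) ^ (1 / 2 : ℝ)) := by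
    intro z
    have h := ENNReal.lintegral_mul_norm_pow_le
      (μ := μ.restrict (Metric.closedBall z R)) (f := fun _ => 1)
      (g := bilinearAverage μ R F Γ) aemeasurable_const hB.aemeasurable
      (p := 1 / 2) (q := 1 / 2) (by norm_num) (by norm_num) (by norm_num)
    simp only [ENNReal.one_rpow, one_mul, setLIntegral_const,
      Measure.addHaar_closedBall_center] at h
    rw [← ENNReal.mul_rpow_of_nonneg _ _ (by norm_num : (0 : ℝ) ≤ 1 / 2)]
    exact h.trans (by gcongr; exact setLIntegral_bilinearAverage_le μ R hF hΓ z)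
  have hglobal : V * ∫⁻ x, bilinearAverage μ R F Γ x ^ (1 / 2 : ℝ) ∂μ
      ≤ V * (2 ^ Module.finrank ℝ E * V ^ (1 / 2 : ℝ)
        * ((∫⁻ x, F x ∂μ) ^ (1 / 2 : ℝ) * (∫⁻ x, Γ x ∂μ) ^ (1 / 2 : ℝ))) := by
    rw [← lintegral_setLIntegral_closedBall μ R (hB.pow_const _)]
    refine (lintegral_mono hlocal).trans ?_
    have hm : ∀ {h : E → ℝ≥0∞}, Measurable h → Measurable fun z =>
      (∫⁻ x in Metric.closedBall z (2 * R), h x ∂μ) ^ (1 / 2 : ℝ) :=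
      fun hh => (hball _ hh).pow_const _
    rw [lintegral_const_mul _ (Measurable.fun_mul (hm hF) (hm hΓ))]
    have h := ENNReal.lintegral_mul_norm_pow_le (μ := μ) (hball (2 * R) hF).aemeasurable
      (hball (2 * R) hΓ).aemeasurable
      (p := 1 / 2) (q := 1 / 2) (by norm_num) (by norm_num) (by norm_num)
    refine (mul_le_mul_right h _).trans (le_of_eq ?_)
    rw [lintegral_setLIntegral_closedBall μ _ hF, lintegral_setLIntegral_closedBall μ _ hΓ, hV2]
    have hsq : ∀ a : ℝ≥0∞, a ^ (1 / 2 : ℝ) * a ^ (1 / 2 : ℝ) = a := fun a => by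
      rw [← ENNReal.rpow_add_of_nonneg _ _ (by norm_num) (by norm_num)]; norm_num
    rw [ENNReal.mul_rpow_of_nonneg (2 ^ Module.finrank ℝ E * V) _ (by norm_num),
      ENNReal.mul_rpow_of_nonneg (2 ^ Module.finrank ℝ E * V) _ (by norm_num)]
    calc _ = V ^ (1 / 2 : ℝ) * (((2 ^ Module.finrank ℝ E * V) ^ (1 / 2 : ℝ)
            * (2 ^ Module.finrank ℝ E * V) ^ (1 / 2 : ℝ))
            * ((∫⁻ x, F x ∂μ) ^ (1 / 2 : ℝ) * (∫⁻ x, Γ x ∂μ) ^ (1 / 2 : ℝ))) := by ring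
      _ = _ := by rw [hsq]; ring
  exact (ENNReal.mul_le_mul_iff_right hV0 hVtop).1 hglobal

lemma tsum_rpow_le_tsum {ι : Type*} (a : ι → ℝ≥0∞) {p : ℝ} (hp0 : 0 < p) (hp1 : p ≤ 1) :
    (∑' i, a i) ^ p ≤ ∑' i, a i ^ p := by
  rw [← ENNReal.le_rpow_inv_iff hp0, ENNReal.tsum_eq_iSup_sum]
  refine iSup_le fun t => ?_
  rw [ENNReal.le_rpow_inv_iff hp0]
  refine le_trans ?_ (ENNReal.sum_le_tsum t)
  exact Finset.le_sum_of_subadditive (fun x : ℝ≥0∞ => x ^ p) (by simp [hp0])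
    (fun x y => ENNReal.rpow_add_le_add_rpow x y hp0.le hp1) t a

/-- A kernel dominated by a countable combination of indicators of balls gives a bilinear
operator mapping `L¹ × L¹` into `L^{1/2}`. -/
lemma lintegral_bilinear_rpow_le {ι : Type*} [Countable ι] {K : E → ℝ≥0∞} {c : ι → ℝ≥0∞}
    {r : ι → ℝ} (hr : ∀ i, 0 < r i)
    (hK : ∀ᵐ y ∂μ, K y ≤ ∑' i, (Metric.closedBall 0 (r i)).indicator (fun _ => c i) y)
    {F Γ : E → ℝ≥0∞} (hF : Measurable F) (hΓ : Measurable Γ) :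
    ∫⁻ x, (∫⁻ y, K y * (F (x - y) * Γ (x + y)) ∂μ) ^ (1 / 2 : ℝ) ∂μ
      ≤ (∑' i, c i ^ (1 / 2 : ℝ) * (2 ^ Module.finrank ℝ E
          * μ (Metric.closedBall 0 (r i)) ^ (1 / 2 : ℝ)))
        * ((∫⁻ x, F x ∂μ) ^ (1 / 2 : ℝ) * (∫⁻ x, Γ x ∂μ) ^ (1 / 2 : ℝ)) := by
  have hb : ∀ i, MeasurableSet (Metric.closedBall (0 : E) (r i)) :=
    fun i => Metric.isClosed_closedBall.measurableSet
  have hpt : ∀ x, (∫⁻ y, K y * (F (x - y) * Γ (x + y)) ∂μ) ^ (1 / 2 : ℝ)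
      ≤ ∑' i, c i ^ (1 / 2 : ℝ) * bilinearAverage μ (r i) F Γ x ^ (1 / 2 : ℝ) := by
    intro x
    have hm : Measurable fun y => F (x - y) * Γ (x + y) := by fun_prop
    have h1 : ∫⁻ y, K y * (F (x - y) * Γ (x + y)) ∂μ
        ≤ ∑' i, c i * bilinearAverage μ (r i) F Γ x := by
      calc _ ≤ ∫⁻ y, ∑' i, (Metric.closedBall 0 (r i)).indicator
              (fun y => c i * (F (x - y) * Γ (x + y))) y ∂μ := by
            refine lintegral_mono_ae (hK.mono fun y hy => ?_)
            refine (mul_le_mul_left hy _).trans (le_of_eq ?_)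
            rw [← ENNReal.tsum_mul_right]
            congr 1 with i
            by_cases hi : y ∈ Metric.closedBall 0 (r i) <;> simp [hi]
        _ = _ := by
            rw [lintegral_tsum fun i => ((hm.const_mul _).indicator (hb i)).aemeasurable]
            congr 1 with i
            rw [lintegral_indicator (hb i), lintegral_const_mul _ hm, bilinearAverage]
    refine (ENNReal.rpow_le_rpow h1 (by norm_num)).trans
      ((tsum_rpow_le_tsum _ (by norm_num) (by norm_num)).trans (le_of_eq ?_))
    congr 1 with i
    exact ENNReal.mul_rpow_of_nonneg _ _ (by norm_num)
  have hB := fun i => (measurable_bilinearAverage μ (r i) hF hΓ).pow_const (1 / 2 : ℝ)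
  refine (lintegral_mono hpt).trans ?_
  rw [lintegral_tsum fun i => ((hB i).const_mul _).aemeasurable, ← ENNReal.tsum_mul_right]
  refine ENNReal.tsum_le_tsum fun i => ?_
  rw [lintegral_const_mul _ (hB i), mul_assoc]
  gcongr
  exact lintegral_bilinearAverage_rpow_le μ (hr i) hF hΓ


lemma exists_dyadic_majorant {X : Type*} [NormedAddCommGroup X] (n : ℕ) {s : ℝ} (hs0 : 0 < s)
    (hsn : s < n) {G : X → ℝ} {C : ℝ} (hC : 0 < C)
    (hG1 : ∀ y, 0 < ‖y‖ → ‖y‖ ≤ 1 → G y ≤ C * ‖y‖ ^ (s - (n : ℝ)))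
    (hG2 : ∀ y, 1 ≤ ‖y‖ → G y ≤ C * Real.exp (-‖y‖ / 4)) :
    ∃ c : ℤ → ℝ, (∀ k, 0 ≤ c k) ∧
      (∀ y, y ≠ 0 → ∃ k : ℤ, ‖y‖ ≤ 2 ^ (k + 1) ∧ G y ≤ c k) ∧
      Summable fun k : ℤ => (c k * ((2 : ℝ) ^ (k + 1)) ^ n) ^ (1 / 2 : ℝ) := by
  set M : ℝ := 4 ^ (n + 1) * (n + 1).factorial with hM
  have hexp : ∀ t : ℝ, 0 < t → Real.exp (-t / 4) ≤ M * (t ^ (n + 1))⁻¹ := by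
    intro t ht
    have h := Real.pow_div_factorial_le_exp (t / 4) (by positivity) (n + 1)
    rw [neg_div, Real.exp_neg]
    refine (inv_anti₀ (by positivity) h).trans (le_of_eq ?_)
    rw [hM, div_pow]
    field_simp
  refine ⟨fun k => if k < 0 then C * ((2 : ℝ) ^ k) ^ (s - (n : ℝ))
    else C * (M * (((2 : ℝ) ^ k) ^ (n + 1))⁻¹), fun k => ?_, fun y hy => ?_, ?_⟩
  · dsimp only
    split_ifs <;> positivity
  · obtain ⟨k, hk1, hk2⟩ := exists_mem_Ioc_zpow (norm_pos_iff.2 hy) (one_lt_two (α := ℝ))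
    refine ⟨k, hk2, ?_⟩
    have h2k : (0 : ℝ) < 2 ^ k := by positivity
    dsimp only
    split_ifs with hk
    · have hy1 : ‖y‖ ≤ 1 := hk2.trans (zpow_le_one_of_nonpos₀ one_le_two (by omega))
      refine (hG1 y (norm_pos_iff.2 hy) hy1).trans ?_
      exact mul_le_mul_of_nonneg_left
        (Real.rpow_le_rpow_of_nonpos h2k hk1.le (by linarith)) hC.le
    · have hy1 : 1 ≤ ‖y‖ := (one_le_zpow₀ one_le_two (by omega)).trans hk1.le
      refine (hG2 y hy1).trans ?_
      gcongr
      refine (hexp _ (by positivity)).trans ?_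
      gcongr
  · apply Summable.of_nat_of_neg_add_one
    · have hq : Summable fun m : ℕ => (C * M * 2 ^ n) ^ (1 / 2 : ℝ)
          * (((2 : ℝ)⁻¹) ^ (1 / 2 : ℝ)) ^ m :=
        (summable_geometric_of_lt_one (by positivity)
          (Real.rpow_lt_one (by norm_num) (by norm_num) (by norm_num))).mul_left _
      refine hq.congr fun m => ?_
      dsimp only
      rw [if_neg (by omega), Real.rpow_pow_comm (by norm_num),
        ← Real.mul_rpow (by positivity) (by positivity)]
      congr 1
      rw [zpow_add_one₀ two_ne_zero, zpow_natCast, mul_pow, pow_succ, inv_pow]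
      field_simp
    · have hq : Summable fun m : ℕ => (C * 2 ^ n) ^ (1 / 2 : ℝ) * ((2 : ℝ)⁻¹ ^ s) ^ (1 / 2 : ℝ)
          * (((2 : ℝ)⁻¹ ^ s) ^ (1 / 2 : ℝ)) ^ m :=
        (summable_geometric_of_lt_one (by positivity)
          (Real.rpow_lt_one (by positivity)
            (Real.rpow_lt_one (by norm_num) (by norm_num) hs0) (by norm_num))).mul_left _
      refine hq.congr fun m => ?_
      set x : ℝ := 2 ^ (-((m : ℤ) + 1)) with hx
      have hx0 : 0 < x := by positivity
      have hx2 : x = 2⁻¹ ^ (m + 1) := by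
        rw [hx, zpow_neg, inv_pow]
        norm_cast
      have hxs : x ^ s = ((2 : ℝ)⁻¹ ^ s) ^ (m + 1) := by
        rw [hx2, Real.rpow_pow_comm (by norm_num)]
      dsimp only
      rw [if_pos (by omega), mul_assoc, ← pow_succ', Real.rpow_pow_comm (by positivity),
        ← Real.mul_rpow (by positivity) (by positivity), zpow_add_one₀ two_ne_zero, ← hx, ← hxs,
        mul_pow, Real.rpow_sub hx0, Real.rpow_natCast]
      congr 1
      field_simp

end BilinearPotential

theorem stmt_7 (n : ℕ) (hn : 0 < n) (s : ℝ) (hs0 : 0 < s) (hsn : s < n)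
    (G : EuclideanSpace ℝ (Fin n) → ℝ) (hGmeas : Measurable G) (hGnn : ∀ y, 0 ≤ G y)
    (C : ℝ) (hC : 0 < C)
    (hG1 : ∀ y : EuclideanSpace ℝ (Fin n), 0 < ‖y‖ → ‖y‖ ≤ 1 → G y ≤ C * ‖y‖ ^ (s - (n : ℝ)))
    (hG2 : ∀ y : EuclideanSpace ℝ (Fin n), 1 ≤ ‖y‖ → G y ≤ C * Real.exp (-‖y‖ / 4)) :
    ∃ C' : ℝ, 0 < C' ∧ ∀ f g : EuclideanSpace ℝ (Fin n) → ℝ,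
      Integrable f volume → Integrable g volume →
      ∫⁻ x, ENNReal.ofReal (|∫ y, G y * f (x - y) * g (x + y)| ^ ((1 : ℝ) / 2))
        ≤ ENNReal.ofReal
            (C' * (∫ y, |f y|) ^ ((1 : ℝ) / 2) * (∫ y, |g y|) ^ ((1 : ℝ) / 2)) := by
  have : Nonempty (Fin n) := ⟨⟨0, hn⟩⟩
  obtain ⟨c, hc0, hcG, hcs⟩ := BilinearPotential.exists_dyadic_majorant n hs0 hsn hC hG1 hG2
  set V : ℝ≥0∞ := volume (Metric.closedBall (0 : EuclideanSpace ℝ (Fin n)) 1) with hV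
  have hVtop : V ≠ ∞ := measure_closedBall_lt_top.ne
  set T : ℝ≥0∞ := ∑' k : ℤ, ENNReal.ofReal (c k) ^ (1 / 2 : ℝ) *
    (2 ^ Module.finrank ℝ (EuclideanSpace ℝ (Fin n)) *
      volume (Metric.closedBall (0 : EuclideanSpace ℝ (Fin n)) (2 ^ (k + 1))) ^ (1 / 2 : ℝ)) with hT
  have hTtop : T ≠ ∞ := by
    have hterm : T = ∑' k : ℤ, ENNReal.ofReal ((c k * ((2 : ℝ) ^ (k + 1)) ^ n) ^ (1 / 2 : ℝ)) *
        (2 ^ n * V ^ (1 / 2 : ℝ)) := by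
      rw [hT]
      congr 1 with k
      rw [Measure.addHaar_closedBall' _ _ (by positivity), finrank_euclideanSpace_fin,
        ENNReal.mul_rpow_of_nonneg _ _ (by norm_num),
        ← ENNReal.ofReal_rpow_of_nonneg (mul_nonneg (hc0 k) (by positivity)) (by norm_num),
        ENNReal.ofReal_mul (hc0 k), ENNReal.mul_rpow_of_nonneg _ _ (by norm_num)]
      ring
    rw [hterm, ENNReal.tsum_mul_right]
    exact ENNReal.mul_ne_top hcs.tsum_ofReal_lt_top.ne (ENNReal.mul_ne_top
      (ENNReal.pow_ne_top ENNReal.ofNat_ne_top) (ENNReal.rpow_ne_top_of_nonneg (by norm_num) hVtop))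
  have hGc : ∀ᵐ y : EuclideanSpace ℝ (Fin n), ‖G y‖ₑ ≤ ∑' k : ℤ,
      (Metric.closedBall 0 (2 ^ (k + 1))).indicator (fun _ => ENNReal.ofReal (c k)) y := by
    filter_upwards [Measure.ae_ne volume (0 : EuclideanSpace ℝ (Fin n))] with y hy
    obtain ⟨k, hk, hGk⟩ := hcG y hy
    refine le_trans ?_ (ENNReal.le_tsum k)
    rw [indicator_of_mem (by simpa using hk), Real.enorm_of_nonneg (hGnn y)]
    exact ENNReal.ofReal_le_ofReal hGk
  refine ⟨T.toReal + 1, by positivity, fun f g hf hg => ?_⟩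
  obtain ⟨f', hf'm, hff'⟩ := hf.aestronglyMeasurable.aemeasurable
  obtain ⟨g', hg'm, hgg'⟩ := hg.aestronglyMeasurable.aemeasurable
  have hpt : ∀ x, ENNReal.ofReal (|∫ y, G y * f (x - y) * g (x + y)| ^ ((1 : ℝ) / 2))
      ≤ (∫⁻ y, ‖G y‖ₑ * (‖f' (x - y)‖ₑ * ‖g' (x + y)‖ₑ)) ^ (1 / 2 : ℝ) := by
    intro x
    rw [← ENNReal.ofReal_rpow_of_nonneg (abs_nonneg _) (by norm_num), ← Real.enorm_eq_ofReal_abs]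
    refine ENNReal.rpow_le_rpow ((enorm_integral_le_lintegral_enorm _).trans (le_of_eq ?_))
      (by norm_num)
    refine lintegral_congr_ae ?_
    filter_upwards [(Measure.measurePreserving_sub_left volume x).quasiMeasurePreserving.ae_eq_comp hff',
      (measurePreserving_add_left volume x).quasiMeasurePreserving.ae_eq_comp hgg'] with y h1 h2
    simp only [Function.comp_apply] at h1 h2
    rw [enorm_mul, enorm_mul, h1, h2, mul_assoc]
  have hint : ∀ {u u' : EuclideanSpace ℝ (Fin n) → ℝ}, Integrable u → u =ᵐ[volume] u' →
      ∫⁻ x, ‖u' x‖ₑ = ENNReal.ofReal (∫ y, |u y|) := fun hu huu' => by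
    simp_rw [← Real.norm_eq_abs]
    rw [ofReal_integral_norm_eq_lintegral_enorm hu]
    exact lintegral_congr_ae (huu'.mono fun x hx => by simp only [hx])
  have hmain := BilinearPotential.lintegral_bilinear_rpow_le volume
    (fun k : ℤ => by positivity) hGc hf'm.enorm hg'm.enorm
  refine (lintegral_mono hpt).trans (hmain.trans ?_)
  have hf0 : 0 ≤ ∫ y, |f y| := integral_nonneg fun _ => abs_nonneg _
  have hg0 : 0 ≤ ∫ y, |g y| := integral_nonneg fun _ => abs_nonneg _
  rw [hint hf hff', hint hg hgg', ← hT, mul_assoc, ENNReal.ofReal_mul (by positivity),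
    ENNReal.ofReal_mul (by positivity), ← ENNReal.ofReal_rpow_of_nonneg hf0 (by norm_num),
    ← ENNReal.ofReal_rpow_of_nonneg hg0 (by norm_num)]
  gcongr
  rw [ENNReal.le_ofReal_iff_toReal_le hTtop (by positivity)]
  linarith
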